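/- Let ν > 0, m ≥ 1 and 0 ≤ θ ≤ ν/2. Let v : ℝ^d → ℝ^d be continuously differentiable with compact support and suppose: (i) the error inequality ν ∫_{Ω_F} |∇v|² dx + νm ∫_{Ω_S} |∇v|² dx ≤ ∫_{Ω_S} f·v dx + ∫_Σ |g·v| d𝓗^{d−1} + θ ∫_Ω |∇v|² dx holds; (ii) the Poincaré inequality ∫_{Ω_S} |v|² dx ≤ C_P ∫_{Ω_S} |∇v|² dx holds for some C_P ≥ 0; (iii) the trace inequality ∫_Σ |v|² d𝓗^{d−1} ≤ C_T ∫_{Ω_S} |∇v|² dx holds for some C_T ≥ 0. Then there is a constant C depending only on C_P, C_T, ∫_{Ω_S} |f|² dx and ∫_Σ |g|² d𝓗^{d−1} (but not on ν or m) such that (∫_{Ω_S} |∇v|² dx)^{1/2} ≤ C · (νm)^{-1}. (This is the improved obstacle estimate (visc:3) of Theorem 2, with v playing the role of u_m, which coincides with u_m − u on the obstacle since u ≡ 0 there.) -/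

import Mathlib

open MeasureTheory
open scoped RealInnerProductSpace

noncomputable section

/-- `|∇v|²(x) = ∑_{i,j} (∂_j v_i(x))²`. -/
def gradSq {d : ℕ} (v : EuclideanSpace ℝ (Fin d) → EuclideanSpace ℝ (Fin d))
    (x : EuclideanSpace ℝ (Fin d)) : ℝ :=
  ∑ j : Fin d, ‖fderiv ℝ v x (EuclideanSpace.single j 1)‖ ^ 2

theorem continuous_gradSq {d : ℕ} {v : EuclideanSpace ℝ (Fin d) → EuclideanSpace ℝ (Fin d)}
    (hv : ContDiff ℝ 1 v) : Continuous (gradSq v) := by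
  have h := hv.continuous_fderiv one_ne_zero
  unfold gradSq
  fun_prop

theorem gradSq_nonneg {d : ℕ} (v : EuclideanSpace ℝ (Fin d) → EuclideanSpace ℝ (Fin d))
    (x : EuclideanSpace ℝ (Fin d)) : 0 ≤ gradSq v x :=
  Finset.sum_nonneg fun _ _ => sq_nonneg _

theorem integrable_gradSq {d : ℕ} {v : EuclideanSpace ℝ (Fin d) → EuclideanSpace ℝ (Fin d)}
    (hv : ContDiff ℝ 1 v) (hc : HasCompactSupport v) : Integrable (gradSq v) := by
  refine (continuous_gradSq hv).integrable_of_hasCompactSupport ?_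
  refine (hc.fderiv (𝕜 := ℝ)).mono fun x hx h => hx ?_
  simp [gradSq, h]

/-- Cauchy–Schwarz for the integral of `|⟪f, v⟫|`; no measurability of `f` itself is needed, since
the integral on the left is zero when the integrand is not integrable. -/
theorem integral_abs_inner_le_sqrt_mul_sqrt {α E : Type*} [MeasurableSpace α]
    [NormedAddCommGroup E] [InnerProductSpace ℝ E] {μ : Measure α} {f v : α → E}
    (hf : Integrable (fun x => ‖f x‖ ^ 2) μ) (hv : MemLp v 2 μ) :
    ∫ x, |⟪f x, v x⟫| ∂μ ≤ √(∫ x, ‖f x‖ ^ 2 ∂μ) * √(∫ x, ‖v x‖ ^ 2 ∂μ) := by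
  have hf_meas : AEStronglyMeasurable (fun x => ‖f x‖) μ := by
    have h := Real.continuous_sqrt.comp_aestronglyMeasurable hf.aestronglyMeasurable
    simpa [Function.comp_def, Real.sqrt_sq (norm_nonneg _)] using h
  have hf2 : MemLp (fun x => ‖f x‖) 2 μ := (memLp_two_iff_integrable_sq hf_meas).2 hf
  have hv2 : MemLp (fun x => ‖v x‖) 2 μ := hv.norm
  have h2 : ENNReal.ofReal 2 = 2 := by simp
  calc ∫ x, |⟪f x, v x⟫| ∂μ ≤ ∫ x, ‖f x‖ * ‖v x‖ ∂μ :=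
        integral_mono_of_nonneg (.of_forall fun _ => abs_nonneg _) (hf2.integrable_mul hv2)
          (.of_forall fun x => abs_real_inner_le_norm (f x) (v x))
    _ ≤ √(∫ x, ‖f x‖ ^ 2 ∂μ) * √(∫ x, ‖v x‖ ^ 2 ∂μ) := by
        have h := integral_mul_le_Lp_mul_Lq_of_nonneg Real.HolderConjugate.two_two (μ := μ)
          (.of_forall fun x => norm_nonneg (f x)) (.of_forall fun x => norm_nonneg (v x))
          (h2 ▸ hf2) (h2 ▸ hv2)
        simpa [Real.sqrt_eq_rpow] using h

theorem integral_abs_inner_le_of_integral_norm_sq_le {α E : Type*} [MeasurableSpace α]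
    [NormedAddCommGroup E] [InnerProductSpace ℝ E] {μ : Measure α} {f v : α → E} {c G : ℝ}
    (hf : Integrable (fun x => ‖f x‖ ^ 2) μ) (hv : MemLp v 2 μ) (hc : 0 ≤ c)
    (h : ∫ x, ‖v x‖ ^ 2 ∂μ ≤ c * G) :
    ∫ x, |⟪f x, v x⟫| ∂μ ≤ √(∫ x, ‖f x‖ ^ 2 ∂μ) * √c * √G := by
  rw [mul_assoc, ← Real.sqrt_mul hc]
  exact (integral_abs_inner_le_sqrt_mul_sqrt hf hv).trans (by gcongr)

/-- The algebraic absorption step: a quadratic quantity with coefficient `a - θ`, `θ ≤ a / 2`,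
controlled by its square root. -/
theorem sqrt_le_two_mul_mul_inv {a G K : ℝ} (ha : 0 < a) (hG : 0 ≤ G) (hK : 0 ≤ K)
    (h : a / 2 * G ≤ K * √G) : √G ≤ 2 * K * a⁻¹ := by
  rcases (Real.sqrt_nonneg G).eq_or_lt with h0 | h0
  · rw [← h0]; positivity
  · rw [← div_eq_mul_inv, le_div_iff₀ ha]
    have h' : a / 2 * √G * √G ≤ K * √G := by rwa [mul_assoc, Real.mul_self_sqrt hG]
    linarith [le_of_mul_le_mul_right h' h0]

/-- Improved obstacle estimate (visc:3) of Theorem 2: under the error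
inequality, the Poincaré inequality on the obstacle and a trace inequality on
the interface, the `H¹`-seminorm of `v = u_m` on the obstacle region is
`O((νm)^{-1})`, with a constant depending only on `C_P`, `C_T`,
`∫_{Ω_S} |f|²` and `∫_Σ |g|²`. -/
theorem viscosity_penalization_improved_obstacle_estimate
    (d : ℕ) (hd : 1 ≤ d) :
    ∃ C : ℝ → ℝ → ℝ → ℝ → ℝ,
      ∀ (Ω ΩS Sig : Set (EuclideanSpace ℝ (Fin d))),
        IsOpen Ω → Bornology.IsBounded Ω → MeasurableSet ΩS → ΩS ⊆ Ω →
        MeasurableSet Sig → μH[(d : ℝ) - 1] Sig < ⊤ →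
      ∀ (f g v : EuclideanSpace ℝ (Fin d) → EuclideanSpace ℝ (Fin d)),
        IntegrableOn (fun x => ‖f x‖ ^ 2) ΩS →
        Integrable (fun x => ‖g x‖ ^ 2) (μH[(d : ℝ) - 1].restrict Sig) →
        ContDiff ℝ 1 v → HasCompactSupport v →
      ∀ (ν m θ C_P C_T : ℝ),
        0 < ν → 1 ≤ m → 0 ≤ θ → θ ≤ ν / 2 → 0 ≤ C_P → 0 ≤ C_T →
        (ν * ∫ x in Ω \ ΩS, gradSq v x) + (ν * m * ∫ x in ΩS, gradSq v x)
          ≤ (∫ x in ΩS, ⟪f x, v x⟫)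
            + (∫ x in Sig, |⟪g x, v x⟫| ∂μH[(d : ℝ) - 1])
            + θ * ∫ x in Ω, gradSq v x →
        (∫ x in ΩS, ‖v x‖ ^ 2) ≤ C_P * ∫ x in ΩS, gradSq v x →
        (∫ x in Sig, ‖v x‖ ^ 2 ∂μH[(d : ℝ) - 1]) ≤ C_T * ∫ x in ΩS, gradSq v x →
        Real.sqrt (∫ x in ΩS, gradSq v x)
          ≤ C C_P C_T (∫ x in ΩS, ‖f x‖ ^ 2)
              (∫ x in Sig, ‖g x‖ ^ 2 ∂μH[(d : ℝ) - 1])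
            * (ν * m)⁻¹ := by
  refine ⟨fun P T a b => 2 * (√a * √P + √b * √T), ?_⟩
  intro Ω ΩS Sig hΩ hΩb hΩS hsub _ hSigfin f g v hf hg hv hvc ν m θ C_P C_T hν hm hθ hθν hP hT
    herr hpoin htrace
  have hgrad := integrable_gradSq hv hvc
  have hvtop (μ : Measure (EuclideanSpace ℝ (Fin d))) [IsFiniteMeasure μ] : MemLp v 2 μ := by
    obtain ⟨B, hB⟩ := hv.continuous.bounded_above_of_compact_support hvc
    exact MemLp.of_bound hv.continuous.aestronglyMeasurable B (.of_forall hB)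
  have : IsFiniteMeasure (volume.restrict ΩS) :=
    isFiniteMeasure_restrict.2 (hΩb.subset hsub).measure_lt_top.ne
  have : IsFiniteMeasure (μH[(d : ℝ) - 1].restrict Sig) := isFiniteMeasure_restrict.2 hSigfin.ne
  have hf_le := integral_abs_inner_le_of_integral_norm_sq_le hf (hvtop _) hP hpoin
  have hg_le := integral_abs_inner_le_of_integral_norm_sq_le hg (hvtop _) hT htrace
  have habs : ∫ x in ΩS, ⟪f x, v x⟫ ≤ ∫ x in ΩS, |⟪f x, v x⟫| :=
    (le_abs_self _).trans (abs_integral_le_integral_abs)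
  have hsplit : ∫ x in Ω, gradSq v x
      = (∫ x in Ω \ ΩS, gradSq v x) + ∫ x in ΩS, gradSq v x := by
    rw [setIntegral_sdiff hΩS hgrad.integrableOn hsub, sub_add_cancel]
  have hF : 0 ≤ ∫ x in Ω \ ΩS, gradSq v x := integral_nonneg (gradSq_nonneg v)
  have hG : 0 ≤ ∫ x in ΩS, gradSq v x := integral_nonneg (gradSq_nonneg v)
  rw [hsplit] at herr
  refine sqrt_le_two_mul_mul_inv (by positivity) hG (by positivity) ?_
  have hνm : θ ≤ ν * m / 2 := by nlinarith
  have hθF := mul_le_mul_of_nonneg_right (show θ ≤ ν by linarith) hF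
  have hθG := mul_le_mul_of_nonneg_right hνm hG
  linarith
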